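/- arXiv:0907.3174 — 3 statements merged into one kernel-verified Lean document; each statement's English description precedes it below -/
import Mathlib

section
/- Let q be a real number with q ≠ 0 and q^j ≠ 1 for every integer j ≥ 1, and let S_n = ∑_{k=0}^{n-1} q^{−k(k−1)/2} / [n,k]_q (so S_0 = 0). Then for every natural number n ≥ 0: (q^{n+1} − 1)(q^{n+1} + 1) · S_{n+1} − (q^{n+2} − 1) · S_n = C(n), where C(n) = (q^{n+1} + q^{3(n+1)} + q^{−n(n−1)/2} + q^{−(n+1)(n−4)/2} − q^{(2+3n−n^2)/2} − q^{−(n+1)(n−2)/2} − 2q^{2(n+1)}) / (q^{n+1} − 1). -/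
open Finset

/-- The Gaussian binomial coefficient `[n,k]_q = ∏_{i=1}^{k} (1 - q^{n-k+i})/(1 - qⁱ)`. -/
noncomputable def qBinom (q : ℝ) (n k : ℕ) : ℝ :=
  ∏ i ∈ Finset.range k, (1 - q ^ (n - k + i + 1)) / (1 - q ^ (i + 1))

/-- The inhomogeneous term `C(n)` in the q-analog of Rockett's identity. -/
noncomputable def qC (q : ℝ) (n : ℕ) : ℝ :=
  (q ^ (n + 1) + q ^ (3 * (n + 1)) + q ^ (-((n : ℤ) * ((n : ℤ) - 1)) / 2) +
      q ^ (-(((n : ℤ) + 1) * ((n : ℤ) - 4)) / 2) - q ^ ((2 + 3 * (n : ℤ) - (n : ℤ) ^ 2) / 2) -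
      q ^ (-(((n : ℤ) + 1) * ((n : ℤ) - 2)) / 2) - 2 * q ^ (2 * (n + 1))) /
    (q ^ (n + 1) - 1)

lemma qB_eq (q : ℝ) (m k : ℕ) : qBinom q (m + k) k =
    ∏ i ∈ Finset.range k, (1 - q ^ (m + i + 1)) / (1 - q ^ (i + 1)) := by
  simp [qBinom]

lemma qB_ne (q : ℝ) (hq1 : ∀ j : ℕ, 1 ≤ j → q ^ j ≠ 1) (m k : ℕ) : qBinom q (m + k) k ≠ 0 := by
  rw [qB_eq, Finset.prod_ne_zero_iff]
  intro i _
  exact div_ne_zero (sub_ne_zero.2 (hq1 _ (by omega)).symm) (sub_ne_zero.2 (hq1 _ (by omega)).symm)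

lemma qB_succ (q : ℝ) (m k : ℕ) : qBinom q (m + (k + 1)) (k + 1) =
    qBinom q (m + k) k * ((1 - q ^ (m + k + 1)) / (1 - q ^ (k + 1))) := by
  rw [qB_eq, qB_eq, Finset.prod_range_succ]

lemma qB_up (q : ℝ) (hq1 : ∀ j : ℕ, 1 ≤ j → q ^ j ≠ 1) (m k : ℕ) :
    qBinom q (m + 1 + k) k * (1 - q ^ (m + 1)) = qBinom q (m + k) k * (1 - q ^ (m + k + 1)) := by
  induction k with
  | zero => simp [qBinom]
  | succ k ih =>
    rw [qB_succ, qB_succ]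
    have e : m + 1 + k + 1 = m + (k + 1) + 1 := by ring
    rw [e]
    linear_combination (1 - q ^ (m + (k + 1) + 1)) / (1 - q ^ (k + 1)) * ih

lemma e_succ (q : ℝ) (hq : q ≠ 0) (k : ℕ) :
    q ^ (-((k : ℤ) * ((k : ℤ) - 1)) / 2) =
      q ^ (-(((k + 1 : ℕ) : ℤ) * (((k + 1 : ℕ) : ℤ) - 1)) / 2) * q ^ k := by
  rw [← zpow_natCast q k, ← zpow_add₀ hq]
  congr 1
  have : -((k : ℤ) * ((k : ℤ) - 1)) =
    -(((k + 1 : ℕ) : ℤ) * (((k + 1 : ℕ) : ℤ) - 1)) + k * 2 := by push_cast; ring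
  rw [this, Int.add_mul_ediv_right _ _ (by norm_num)]

lemma partial_sum (q : ℝ) (hq : q ≠ 0) (hq1 : ∀ j : ℕ, 1 ≤ j → q ^ j ≠ 1) (n m : ℕ)
    (hm : m ≤ n) :
    (q ^ (n + 1) - 1) * (q ^ (n + 1) + 1) *
        (∑ k ∈ Finset.range m, q ^ (-((k : ℤ) * ((k : ℤ) - 1)) / 2) / qBinom q (n + 1) k) -
      (q ^ (n + 2) - 1) *
        (∑ k ∈ Finset.range m, q ^ (-((k : ℤ) * ((k : ℤ) - 1)) / 2) / qBinom q n k) =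
      q ^ (n + 1) * (1 - q ^ (n + 1)) *
        (q ^ (-((m : ℤ) * ((m : ℤ) - 1)) / 2) / qBinom q (n + 1) m - 1) := by
  induction m with
  | zero => simp [qBinom]
  | succ k ih =>
    have ih := ih (by omega)
    rw [Finset.sum_range_succ, Finset.sum_range_succ]
    obtain ⟨j, rfl⟩ : ∃ j, n = j + 1 + k := ⟨n - (k + 1), by omega⟩
    have e1 : j + 1 + k + 1 = j + 1 + (k + 1) := by ring
    have e2 : j + 1 + (k + 1) = j + 1 + 1 + k := by ring
    have h1 := qB_up q hq1 (j + 1) k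
    have h2 := qB_succ q (j + 1) k
    have n1 := qB_ne q hq1 (j + 1 + 1) k
    have n2 := qB_ne q hq1 (j + 1) k
    have d1 : 1 - q ^ (j + 1 + k + 1) ≠ 0 := sub_ne_zero.2 (hq1 _ (by omega)).symm
    have d2 : 1 - q ^ (j + 1 + 1) ≠ 0 := sub_ne_zero.2 (hq1 _ (by omega)).symm
    have d3 : 1 - q ^ (k + 1) ≠ 0 := sub_ne_zero.2 (hq1 _ (by omega)).symm
    have n3 : q ^ k ≠ 0 := pow_ne_zero _ hq
    have g1 : qBinom q (j + 1 + k) k =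
        qBinom q (j + 1 + 1 + k) k * (1 - q ^ (j + 1 + 1)) / (1 - q ^ (j + 1 + k + 1)) := by
      rw [eq_div_iff d1]; exact h1.symm
    have g2 : qBinom q (j + 1 + (k + 1)) (k + 1) =
        qBinom q (j + 1 + 1 + k) k * (1 - q ^ (j + 1 + 1)) / (1 - q ^ (k + 1)) := by
      rw [h2, h1]; ring
    have hE := e_succ q hq k
    have aux : ∀ A B s t a b r : ℝ, A * s - B * t = r →
        A * (s + a) - B * (t + b) = r + (A * a - B * b) := by
      intro A B s t a b r h
      linear_combination h
    rw [aux _ _ _ _ _ _ _ ih]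
    have e3 : qBinom q (j + 1 + k + 1) k = qBinom q (j + 1 + 1 + k) k := by
      rw [e1, e2]
    have e4 : qBinom q (j + 1 + k + 1) (k + 1) = qBinom q (j + 1 + (k + 1)) (k + 1) := by
      rw [e1]
    rw [e3, e4, g2, g1, hE]
    generalize q ^ (-(((k + 1 : ℕ) : ℤ) * (((k + 1 : ℕ) : ℤ) - 1)) / 2) = E
    generalize qBinom q (j + 1 + 1 + k) k = p at *
    have p1 : q ^ (j + 1 + k + 2) = q * (q ^ (j + 1 + 1) * q ^ k) := by ring
    have p2 : q ^ (j + 1 + k + 1) = q ^ (j + 1 + 1) * q ^ k := by ring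
    have p3 : q ^ (k + 1) = q * q ^ k := by ring
    rw [p2] at d1
    rw [p3] at d3
    rw [p1, p2, p3]
    generalize q ^ (j + 1 + 1) = y at *
    generalize q ^ k = x at *
    field_simp
    ring

theorem upside_down_q_binomial_recurrence (q : ℝ) (hq : q ≠ 0)
    (hq1 : ∀ j : ℕ, 1 ≤ j → q ^ j ≠ 1) (n : ℕ) :
    (q ^ (n + 1) - 1) * (q ^ (n + 1) + 1) *
        (∑ k ∈ Finset.range (n + 1), q ^ (-((k : ℤ) * ((k : ℤ) - 1)) / 2) / qBinom q (n + 1) k) -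
      (q ^ (n + 2) - 1) *
        (∑ k ∈ Finset.range n, q ^ (-((k : ℤ) * ((k : ℤ) - 1)) / 2) / qBinom q n k) =
      qC q n := by
  rw [Finset.sum_range_succ, mul_add, add_sub_right_comm, partial_sum q hq hq1 n n le_rfl]
  have hB : qBinom q (n + 1) n = (1 - q ^ (n + 1)) / (1 - q) := by
    have h := qB_up q hq1 0 n
    have h0 : qBinom q (0 + n) n = 1 := by
      rw [qB_eq]
      apply Finset.prod_eq_one
      intro i _
      rw [zero_add]
      exact div_self (sub_ne_zero.2 (hq1 _ (by omega)).symm)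
    have d : (1 - q) ≠ 0 := sub_ne_zero.2 (by simpa using (hq1 1 le_rfl).symm)
    rw [h0] at h
    rw [eq_div_iff d]
    have e : 0 + 1 + n = n + 1 := by ring
    rw [e] at h
    simpa using h
  have d : (1 - q) ≠ 0 := sub_ne_zero.2 (by simpa using (hq1 1 le_rfl).symm)
  have dN : (1 - q ^ (n + 1)) ≠ 0 := sub_ne_zero.2 (hq1 _ (by omega)).symm
  have dN' : (q ^ (n + 1) - 1) ≠ 0 := sub_ne_zero.2 (hq1 _ (by omega))
  have key : ∀ (a : ℤ) (b : ℕ), a = -((n : ℤ) * ((n : ℤ) - 1)) + (b : ℤ) * 2 →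
      q ^ (a / 2) = q ^ (-((n : ℤ) * ((n : ℤ) - 1)) / 2) * q ^ b := by
    intro a b h
    rw [h, Int.add_mul_ediv_right _ _ (by norm_num), zpow_add₀ hq, zpow_natCast]
  rw [qC, key (-(((n : ℤ) + 1) * ((n : ℤ) - 4))) (n + 2) (by push_cast; ring),
    key (2 + 3 * (n : ℤ) - (n : ℤ) ^ 2) (n + 1) (by push_cast; ring),
    key (-(((n : ℤ) + 1) * ((n : ℤ) - 2))) 1 (by push_cast; ring), hB]
  generalize q ^ (-((n : ℤ) * ((n : ℤ) - 1)) / 2) = E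
  have p1 : q ^ (n + 2) = q * q ^ (n + 1) := by ring
  have p2 : q ^ (3 * (n + 1)) = (q ^ (n + 1)) ^ 3 := by ring
  have p3 : q ^ (2 * (n + 1)) = (q ^ (n + 1)) ^ 2 := by ring
  rw [p1, p2, p3]
  generalize q ^ (n + 1) = N at *
  rw [eq_div_iff dN']
  field_simp
  ring
end

section
/- Let a, n be natural numbers with n ≤ a and let S_m = ∑_{k=0}^{m-1} (C(m,k))^{-1} (C(a,n−k))^{-1} as a real number (so S_0 = 0). Then for every natural number m with 0 ≤ m ≤ n: (a+m+4)(m+1) · S_{m+1} − (m+2)(a+m−n+2) · S_m = C(m), where C(m) = (n + m + m·n + 1) / C(a,n) + (2m + a − n + 3) / C(a, n−m). -/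
open Finset

/-- The inhomogeneous term `C(m)` in the upside-down Chu-Vandermonde recurrence. -/
noncomputable def cvC (a n m : ℕ) : ℝ :=
  ((n : ℝ) + (m : ℝ) + (m : ℝ) * (n : ℝ) + 1) / (a.choose n : ℝ) +
    (2 * (m : ℝ) + (a : ℝ) - (n : ℝ) + 3) / (a.choose (n - m) : ℝ)

theorem cv_aux (A B s t u v : ℝ) :
    A * (s + u) - B * (t + v) = (A * s - B * t) + (A * u - B * v) := by ring

theorem cv_partial (a n m : ℕ) (han : n ≤ a) (hmn : m ≤ n) (j : ℕ) (hj : j ≤ m) :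
    ((a : ℝ) + (m : ℝ) + 4) * ((m : ℝ) + 1) *
        (∑ k ∈ Finset.range j, ((m + 1).choose k : ℝ)⁻¹ * (a.choose (n - k) : ℝ)⁻¹) -
      ((m : ℝ) + 2) * ((a : ℝ) + (m : ℝ) - (n : ℝ) + 2) *
        (∑ k ∈ Finset.range j, (m.choose k : ℝ)⁻¹ * (a.choose (n - k) : ℝ)⁻¹) =
      ((m : ℝ) + 1) * (n + 1) * (a.choose n : ℝ)⁻¹ -
        ((m : ℝ) + 1 - j) * (n + 1 - j) * ((m.choose j : ℝ)⁻¹ * (a.choose (n - j) : ℝ)⁻¹) := by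
  induction j with
  | zero => simp
  | succ j ih =>
    have ih := ih (by omega)
    rw [Finset.sum_range_succ, Finset.sum_range_succ]
    obtain ⟨p, rfl⟩ : ∃ p, m = j + 1 + p := ⟨m - (j + 1), by omega⟩
    obtain ⟨q, rfl⟩ : ∃ q, n = j + 1 + q := ⟨n - (j + 1), by omega⟩
    obtain ⟨r, rfl⟩ : ∃ r, a = j + 1 + q + r := ⟨a - (j + 1 + q), by omega⟩
    have e1 : j + 1 + q - j = q + 1 := by omega
    have e2 : j + 1 + q - (j + 1) = q := by omega
    rw [e1] at ih
    rw [e1, e2]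
    have h1 := Nat.choose_succ_right_eq (j + 1 + p) j
    have h2 := Nat.choose_succ_right_eq (j + 1 + q + r) q
    have h3 := Nat.choose_mul_succ_eq (j + 1 + p) j
    rw [show j + 1 + p - j = p + 1 by omega] at h1
    rw [show j + 1 + q + r - q = j + 1 + r by omega] at h2
    rw [show j + 1 + p + 1 - j = p + 2 by omega] at h3
    have p1 : ((j + 1 + p).choose j : ℝ) ≠ 0 := by
      exact_mod_cast (Nat.choose_pos (by omega)).ne'
    have p2 : ((j + 1 + q + r).choose q : ℝ) ≠ 0 := by
      exact_mod_cast (Nat.choose_pos (by omega)).ne'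
    have h1' : ((j + 1 + p).choose (j + 1) : ℝ) = (j + 1 + p).choose j * (p + 1) / (j + 1) := by
      rw [eq_div_iff (by positivity)]; exact_mod_cast h1
    have h2' : ((j + 1 + q + r).choose (q + 1) : ℝ)
        = (j + 1 + q + r).choose q * (j + 1 + r) / (q + 1) := by
      rw [eq_div_iff (by positivity)]; exact_mod_cast h2
    have h3' : ((j + 1 + p + 1).choose j : ℝ)
        = (j + 1 + p).choose j * (j + 1 + p + 1) / (p + 2) := by
      rw [eq_div_iff (by positivity)]; exact_mod_cast h3.symm
    rw [cv_aux, ih, h1', h2', h3']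
    generalize ((j + 1 + p).choose j : ℝ) = x at *
    generalize ((j + 1 + q + r).choose q : ℝ) = y at *
    generalize ((j + 1 + q + r).choose (j + 1 + q) : ℝ)⁻¹ = z at *
    push_cast
    have : (p : ℝ) + 1 ≠ 0 := by positivity
    have : (p : ℝ) + 2 ≠ 0 := by positivity
    have : (q : ℝ) + 1 ≠ 0 := by positivity
    have : (j : ℝ) + 1 ≠ 0 := by positivity
    have : (j : ℝ) + 1 + r ≠ 0 := by positivity
    have : (j : ℝ) + 1 + p + 1 ≠ 0 := by positivity
    field_simp
    ring

theorem upside_down_chu_vandermonde_recurrence (a n m : ℕ) (han : n ≤ a) (hmn : m ≤ n) :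
    ((a : ℝ) + (m : ℝ) + 4) * ((m : ℝ) + 1) *
        (∑ k ∈ Finset.range (m + 1), ((m + 1).choose k : ℝ)⁻¹ * (a.choose (n - k) : ℝ)⁻¹) -
      ((m : ℝ) + 2) * ((a : ℝ) + (m : ℝ) - (n : ℝ) + 2) *
        (∑ k ∈ Finset.range m, (m.choose k : ℝ)⁻¹ * (a.choose (n - k) : ℝ)⁻¹) =
      cvC a n m := by
  have h := cv_partial a n m han hmn m le_rfl
  rw [Finset.sum_range_succ, mul_add _ (∑ k ∈ Finset.range m, _), add_sub_right_comm, h, cvC]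
  have e : ((m + 1).choose m : ℝ) = m + 1 := by
    rw [Nat.choose_succ_self_right]; push_cast; ring
  rw [e, Nat.choose_self]
  have : (m : ℝ) + 1 ≠ 0 := by positivity
  simp only [div_eq_mul_inv, Nat.cast_one, inv_one]
  have e3 : ((a : ℝ) + m + 4) * (m + 1) * (((m : ℝ) + 1)⁻¹ * (a.choose (n - m) : ℝ)⁻¹)
      = (a + m + 4) * (a.choose (n - m) : ℝ)⁻¹ := by
    rw [mul_assoc, mul_inv_cancel_left₀ this]
  rw [e3]
  ring
end

section
/- Let b, c be natural numbers and let S_n = ∑_{k=0}^{n-1} (−1)^k (C(n+b, n+k))^{-1} (C(n+c, c+k))^{-1} (C(b+c, b+k))^{-1} as a real number (so S_0 = 0). Then for every natural number n with n ≤ b and n ≤ c: 2(c+n+1)(b+n+1)(b+c+n+3) · S_{n+1} − 2(n+1)(c+n+2)(b+n+2) · S_n = C(n), where C(n) = (−1)^n (3bn + 3cn + bc + 3b + 5n^2 + 12n + 3c + 7) · (C(n+b, 2n))^{-1} (C(b+c, b+n))^{-1} − (b+1)(c+1)(n+1) · (C(n+b, n))^{-1} (C(n+c, c))^{-1} (C(b+c,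 b))^{-1}. -/
open Finset

/-- The inhomogeneous term `C(n)` in the upside-down Dixon recurrence. -/
noncomputable def dixC (b c n : ℕ) : ℝ :=
  (-1 : ℝ) ^ n *
        (3 * (b : ℝ) * (n : ℝ) + 3 * (c : ℝ) * (n : ℝ) + (b : ℝ) * (c : ℝ) + 3 * (b : ℝ) +
          5 * (n : ℝ) ^ 2 + 12 * (n : ℝ) + 3 * (c : ℝ) + 7) *
        ((n + b).choose (2 * n) : ℝ)⁻¹ * ((b + c).choose (b + n) : ℝ)⁻¹ -
    ((b : ℝ) + 1) * ((c : ℝ) + 1) * ((n : ℝ) + 1) * ((n + b).choose n : ℝ)⁻¹ *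
      ((n + c).choose c : ℝ)⁻¹ * ((b + c).choose b : ℝ)⁻¹

/-- Ratio of inverse binomials, both arguments shifted. -/
lemma dix_L1 (N K : ℕ) (h : K ≤ N) :
    ((N : ℝ) + 1) * ((N + 1).choose (K + 1) : ℝ)⁻¹ = ((K : ℝ) + 1) * (N.choose K : ℝ)⁻¹ := by
  have h1 : (N.choose K : ℝ) ≠ 0 := by exact_mod_cast (Nat.choose_pos h).ne'
  have h2 : ((N + 1).choose (K + 1) : ℝ) ≠ 0 := by
    exact_mod_cast (Nat.choose_pos (Nat.succ_le_succ h)).ne'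
  have h3 : ((N : ℝ) + 1) * (N.choose K : ℝ) = ((N + 1).choose (K + 1) : ℝ) * ((K : ℝ) + 1) := by
    exact_mod_cast Nat.add_one_mul_choose_eq N K
  field_simp
  linarith

/-- Ratio of inverse binomials, top argument shifted. -/
lemma dix_L2 (N K : ℕ) (h : K ≤ N) :
    ((N : ℝ) + 1) * ((N + 1).choose K : ℝ)⁻¹ = ((N : ℝ) + 1 - K) * (N.choose K : ℝ)⁻¹ := by
  have h1 : (N.choose K : ℝ) ≠ 0 := by exact_mod_cast (Nat.choose_pos h).ne'
  have h2 : ((N + 1).choose K : ℝ) ≠ 0 := by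
    exact_mod_cast (Nat.choose_pos (Nat.le_succ_of_le h)).ne'
  have h3 := congrArg (Nat.cast : ℕ → ℝ) (Nat.choose_mul_succ_eq N K)
  rw [Nat.cast_mul, Nat.cast_mul, Nat.cast_sub (by omega)] at h3
  push_cast at h3
  field_simp
  linarith

/-- Ratio of inverse binomials, bottom argument shifted. -/
lemma dix_L3 (N K : ℕ) (h : K < N) :
    ((N : ℝ) - K) * (N.choose (K + 1) : ℝ)⁻¹ = ((K : ℝ) + 1) * (N.choose K : ℝ)⁻¹ := by
  have h1 : (N.choose K : ℝ) ≠ 0 := by exact_mod_cast (Nat.choose_pos h.le).ne'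
  have h2 : (N.choose (K + 1) : ℝ) ≠ 0 := by exact_mod_cast (Nat.choose_pos h).ne'
  have h3 := congrArg (Nat.cast : ℕ → ℝ) (Nat.choose_succ_right_eq N K)
  rw [Nat.cast_mul, Nat.cast_mul, Nat.cast_sub h.le] at h3
  push_cast at h3
  field_simp
  linarith

/-- The summand. -/
noncomputable def dixT (b c n k : ℕ) : ℝ :=
  (-1 : ℝ) ^ k * ((n + b).choose (n + k) : ℝ)⁻¹ * ((n + c).choose (c + k) : ℝ)⁻¹ *
            ((b + c).choose (b + k) : ℝ)⁻¹

/-- The telescoping certificate. -/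
noncomputable def dixG (b c n k : ℕ) : ℝ :=
  dixT b c n k * ((n : ℝ) + 1 - k) * ((b : ℝ) + 1 - k) * ((c : ℝ) + 1 - k)

lemma dixT_n (b c n k : ℕ) (hb : k ≤ b) (hn : k ≤ n) :
    ((c : ℝ) + n + 1) * ((b : ℝ) + n + 1) * dixT b c (n + 1) k =
      ((n : ℝ) + 1 + k) * ((n : ℝ) + 1 - k) * dixT b c n k := by
  have e1 := dix_L1 (n + b) (n + k) (by omega)
  have e2 := dix_L2 (n + c) (c + k) (by omega)
  rw [show n + b + 1 = n + 1 + b by ring, show n + k + 1 = n + 1 + k by ring] at e1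
  rw [show n + c + 1 = n + 1 + c by ring] at e2
  push_cast at e1 e2
  unfold dixT
  linear_combination (-1 : ℝ) ^ k * ((b + c).choose (b + k) : ℝ)⁻¹ *
    (((c : ℝ) + n + 1) * ((n + 1 + c).choose (c + k) : ℝ)⁻¹ * e1 +
      ((n : ℝ) + 1 + k) * ((n + b).choose (n + k) : ℝ)⁻¹ * e2)

lemma dixG_succ (b c n k : ℕ) (hb : k < b) (hc : k < c) (hn : k < n) :
    dixG b c n (k + 1) =
      -(((n : ℝ) + k + 1) * ((c : ℝ) + k + 1) * ((b : ℝ) + k + 1) * dixT b c n k) := by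
  have e1 := dix_L3 (n + b) (n + k) (by omega)
  have e2 := dix_L3 (n + c) (c + k) (by omega)
  have e3 := dix_L3 (b + c) (b + k) (by omega)
  unfold dixG dixT
  simp only [← add_assoc]
  push_cast at e1 e2 e3 ⊢
  rw [pow_succ]
  generalize (((n + b).choose (n + k + 1) : ℕ) : ℝ)⁻¹ = x' at *
  generalize (((n + c).choose (c + k + 1) : ℕ) : ℝ)⁻¹ = y' at *
  generalize (((b + c).choose (b + k + 1) : ℕ) : ℝ)⁻¹ = z' at *
  generalize (((n + b).choose (n + k) : ℕ) : ℝ)⁻¹ = x at *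
  generalize (((n + c).choose (c + k) : ℕ) : ℝ)⁻¹ = y at *
  generalize (((b + c).choose (b + k) : ℕ) : ℝ)⁻¹ = z at *
  linear_combination -(-1 : ℝ) ^ k * (
    ((n : ℝ) - k) * y' * ((c : ℝ) - k) * z' * e1 +
    ((n : ℝ) + k + 1) * x * ((c : ℝ) - k) * z' * e2 +
    ((n : ℝ) + k + 1) * x * ((c : ℝ) + k + 1) * y * e3)

theorem upside_down_dixon_recurrence (b c n : ℕ) (hnb : n ≤ b) (hnc : n ≤ c) :
    2 * ((c : ℝ) + (n : ℝ) + 1) * ((b : ℝ) + (n : ℝ) + 1) * ((b : ℝ) + (c : ℝ) + (n : ℝ) + 3) *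
        (∑ k ∈ Finset.range (n + 1),
          (-1 : ℝ) ^ k * ((n + 1 + b).choose (n + 1 + k) : ℝ)⁻¹ *
            ((n + 1 + c).choose (c + k) : ℝ)⁻¹ * ((b + c).choose (b + k) : ℝ)⁻¹) -
      2 * ((n : ℝ) + 1) * ((c : ℝ) + (n : ℝ) + 2) * ((b : ℝ) + (n : ℝ) + 2) *
        (∑ k ∈ Finset.range n,
          (-1 : ℝ) ^ k * ((n + b).choose (n + k) : ℝ)⁻¹ * ((n + c).choose (c + k) : ℝ)⁻¹ *
            ((b + c).choose (b + k) : ℝ)⁻¹) =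
      dixC b c n := by
  have h : ∀ m, m ≤ n →
      2 * ((c : ℝ) + (n : ℝ) + 1) * ((b : ℝ) + (n : ℝ) + 1) *
        ((b : ℝ) + (c : ℝ) + (n : ℝ) + 3) * (∑ k ∈ Finset.range m, dixT b c (n + 1) k) -
      2 * ((n : ℝ) + 1) * ((c : ℝ) + (n : ℝ) + 2) * ((b : ℝ) + (n : ℝ) + 2) *
        (∑ k ∈ Finset.range m, dixT b c n k) = dixG b c n m - dixG b c n 0 := by
    intro m
    induction m with
    | zero => intro _; simp
    | succ m ih =>
      intro hm
      have ih := ih (by omega)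
      have e1 := dixT_n b c n m (by omega) (by omega)
      have e2 := dixG_succ b c n m (by omega) (by omega) (by omega)
      rw [Finset.sum_range_succ, Finset.sum_range_succ, e2]
      have e3 : dixG b c n m = dixT b c n m * ((n : ℝ) + 1 - m) * ((b : ℝ) + 1 - m) *
        ((c : ℝ) + 1 - m) := rfl
      rw [e3] at ih
      linear_combination ih + 2 * ((b : ℝ) + (c : ℝ) + (n : ℝ) + 3) * e1
  have h0 := h n le_rfl
  have e1 := dixT_n b c n n hnb le_rfl
  change 2 * ((c : ℝ) + (n : ℝ) + 1) * ((b : ℝ) + (n : ℝ) + 1) *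
      ((b : ℝ) + (c : ℝ) + (n : ℝ) + 3) * (∑ k ∈ Finset.range (n + 1), dixT b c (n + 1) k) -
      2 * ((n : ℝ) + 1) * ((c : ℝ) + (n : ℝ) + 2) * ((b : ℝ) + (n : ℝ) + 2) *
        (∑ k ∈ Finset.range n, dixT b c n k) = dixC b c n
  rw [Finset.sum_range_succ]
  have eT : dixT b c n n = (-1 : ℝ) ^ n * ((n + b).choose (2 * n) : ℝ)⁻¹ *
      ((b + c).choose (b + n) : ℝ)⁻¹ := by
    unfold dixT
    rw [add_comm n c, Nat.choose_self, two_mul]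
    simp
  have eG : dixG b c n n = dixT b c n n * ((b : ℝ) + 1 - n) * ((c : ℝ) + 1 - n) := by
    unfold dixG
    ring
  have eG0 : dixG b c n 0 = ((b : ℝ) + 1) * ((c : ℝ) + 1) * ((n : ℝ) + 1) *
      ((n + b).choose n : ℝ)⁻¹ * ((n + c).choose c : ℝ)⁻¹ * ((b + c).choose b : ℝ)⁻¹ := by
    unfold dixG dixT
    simp only [add_zero, pow_zero, Nat.cast_zero]
    ring
  rw [eG, eG0, eT] at h0
  rw [eT] at e1
  unfold dixC
  linear_combination h0 + 2 * ((b : ℝ) + (c : ℝ) + (n : ℝ) + 3) * e1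
end
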